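/- Let MELL∞ be PLL∞ extended with the digging rule ??d, and let D_??d be the MELL∞ coderivation of ⊢ !!N obtained by cutting the non-wellfounded box ⟨0,1,0,1,...⟩ of conclusion ⊢ !N (whose calls alternate between the derivations 0 and 1 of ⊢ N) against the coderivation obtained by applying ??d to the axiom ⊢ ??N^⊥, !!N. Then ⟦D_??d⟧ ≠ ⟦D'⟧ for every cut-free coderivation D' of MELL∞ with conclusion ⊢ !!N. Consequently, for every subset X of MELL∞ containing D_??d and every cut-elimination relation →+ on X that contains the relation → and reduces every coderivation in X to a cut-free coderivation with the same conclusion, →+ does not preserve relational semantics. -/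

import Mathlib

namespace NWPLL

/-! ## Formulas and sequents -/

inductive Formula : Type where
  | var : ℕ → Formula
  | covar : ℕ → Formula
  | tens : Formula → Formula → Formula
  | parr : Formula → Formula → Formula
  | bang : Formula → Formula
  | quest : Formula → Formula
  | one : Formula
  | bot : Formula
deriving DecidableEq

/-- Linear negation, defined by De Morgan duality. -/
def Formula.neg : Formula → Formula
  | .var n => .covar n
  | .covar n => .var n
  | .tens A B => .parr A.neg B.neg
  | .parr A B => .tens A.neg B.neg
  | .bang A => .quest A.neg
  | .quest A => .bang A.neg
  | .one => .bot
  | .bot => .one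

/-- A sequent is a finite list of formula occurrences. -/
abbrev Sequent := List Formula

/-! ## Rules -/

inductive RuleName : Type where
  | ax | cut | tens | parr | one | bot | qw | qb | cp | fp | hyp | dig
deriving DecidableEq

/-- Canonical instances of the rules (principal formulas at the head,
conclusion of a rule together with the list of its premises, in order). -/
inductive Canon : RuleName → Sequent → List Sequent → Prop where
  | ax (A : Formula) : Canon .ax [A, A.neg] []
  | cut (A : Formula) (Γ Δ : Sequent) : Canon .cut (Γ ++ Δ) [A :: Γ, A.neg :: Δ]
  | tens (A B : Formula) (Γ Δ : Sequent) :
      Canon .tens (A.tens B :: (Γ ++ Δ)) [A :: Γ, B :: Δ]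
  | parr (A B : Formula) (Γ : Sequent) : Canon .parr (A.parr B :: Γ) [A :: B :: Γ]
  | one : Canon .one [.one] []
  | bot (Γ : Sequent) : Canon .bot (.bot :: Γ) [Γ]
  | qw (A : Formula) (Γ : Sequent) : Canon .qw (A.quest :: Γ) [Γ]
  | qb (A : Formula) (Γ : Sequent) : Canon .qb (A.quest :: Γ) [A :: A.quest :: Γ]
  | cp (A : Formula) (Γ : Sequent) :
      Canon .cp (A.bang :: Γ.map .quest) [A :: Γ, A.bang :: Γ.map .quest]
  | fp (A : Formula) (Γ : Sequent) : Canon .fp (A.bang :: Γ.map .quest) [A :: Γ]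
  | hyp (Γ : Sequent) : Canon .hyp Γ []
  | dig (A : Formula) (Γ : Sequent) : Canon .dig (A.quest :: Γ) [A.quest.quest :: Γ]

/-- A rule instance: a canonical instance up to permutation of each sequent
(sequents are lists of occurrences, managed up to exchange). -/
def RuleOk (r : RuleName) (C : Sequent) (ps : List Sequent) : Prop :=
  ∃ C₀ ps₀, Canon r C₀ ps₀ ∧ C.Perm C₀ ∧ List.Forall₂ List.Perm ps ps₀

/-! ## Coderivations -/

/-- Nodes of a binary tree: `false` = first (left) child, `true` = second (right) child. -/
abbrev Node := List Bool

/-- A (possibly non-wellfounded) coderivation skeleton: a labelling of an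
ordered-prefix-closed binary tree by pairs (rule name, sequent). -/
structure Coderivation : Type where
  label : Node → Option (RuleName × Sequent)
  root_isSome : (label []).isSome
  prefix_closed : ∀ v b, (label (v ++ [b])).isSome → (label v).isSome
  ordered : ∀ v, (label (v ++ [true])).isSome → (label (v ++ [false])).isSome

namespace Coderivation

def mem (D : Coderivation) (v : Node) : Prop := (D.label v).isSome

def ruleAt (D : Coderivation) (v : Node) : Option RuleName := (D.label v).map Prod.fst

def seqAt (D : Coderivation) (v : Node) : Option Sequent := (D.label v).map Prod.snd

def conclusion (D : Coderivation) : Sequent := ((D.label []).map Prod.snd).getD []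

/-- The list of premises (sequents of the children) of the rule at node `v`. -/
def premsAt (D : Coderivation) (v : Node) : List Sequent :=
  (D.seqAt (v ++ [false])).toList ++ (D.seqAt (v ++ [true])).toList

/-- `D` is a coderivation over the set of rules `S`: each node is a valid
instance of a rule of `S`. -/
def IsOver (D : Coderivation) (S : Set RuleName) : Prop :=
  ∀ v r Γ, D.label v = some (r, Γ) → r ∈ S ∧ RuleOk r Γ (D.premsAt v)

def IsFinite (D : Coderivation) : Prop := {v : Node | D.mem v}.Finite

end Coderivation

/-! ## Systems -/

def pllRules : Set RuleName := {.ax, .cut, .tens, .parr, .one, .bot, .qw, .qb, .fp}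
def pllInfRules : Set RuleName := {.ax, .cut, .tens, .parr, .one, .bot, .qw, .qb, .cp}
def oPllInfRules : Set RuleName := insert .hyp pllInfRules
def mellInfRules : Set RuleName := insert .dig pllInfRules

/-- Coderivations of `PLL∞`. -/
def PLLinf (D : Coderivation) : Prop := D.IsOver pllInfRules
/-- Open coderivations (`oPLL∞`). -/
def OPLLinf (D : Coderivation) : Prop := D.IsOver oPllInfRules
/-- Coderivations of `MELL∞` (with digging). -/
def MELLinf (D : Coderivation) : Prop := D.IsOver mellInfRules
/-- Finite derivations of the sequent calculus `PLL` (with functorial promotion). -/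
def IsPLLDer (D : Coderivation) : Prop := D.IsOver pllRules ∧ D.IsFinite

/-! ## Branches and global conditions -/

/-- The node at depth `n` along the infinite branch determined by the
direction function `β`. -/
def brNode (β : ℕ → Bool) (n : ℕ) : Node := (List.range n).map β

def InfBranch (D : Coderivation) (β : ℕ → Bool) : Prop := ∀ n, D.mem (brNode β n)

/-- Weak progressing: every infinite branch goes through the right premise of
a `c!p` rule infinitely often. -/
def WeaklyProg (D : Coderivation) : Prop :=
  ∀ β, InfBranch D β →
    ∀ N, ∃ n, N ≤ n ∧ β n = true ∧ D.ruleAt (brNode β n) = some .cp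

/-- Position of the parent (in canonical instances): `childParent r k b p` is
the position in the conclusion of which the formula at position `p` of premise
`b` is the parent; `k` is the length of the first premise. -/
def childParent : RuleName → ℕ → Bool → ℕ → Option ℕ
  | .cut, _, false, p => if p = 0 then none else some (p - 1)
  | .cut, k, true, p => if p = 0 then none else some (k - 1 + (p - 1))
  | .tens, _, false, p => if p = 0 then some 0 else some p
  | .tens, k, true, p => if p = 0 then some 0 else some (k + (p - 1))
  | .parr, _, false, p => if p ≤ 1 then some 0 else some (p - 1)
  | .bot, _, false, p => some (p + 1)
  | .qw, _, false, p => some (p + 1)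
  | .qb, _, false, p => if p = 0 then none else some (p - 1)
  | .cp, _, false, _ => none
  | .cp, _, true, p => some p
  | .fp, _, false, p => some p
  | .dig, _, false, p => some p
  | _, _, _, _ => none

/-- A position-preserving alignment between a sequent and (a permutation of
it given by) a canonical sequent. -/
def PosAlign (l l' : List Formula) (f : ℕ → ℕ) : Prop :=
  l.length = l'.length ∧
  (∀ i, i < l.length → f i < l'.length ∧ l'[f i]? = l[i]?) ∧
  (∀ i j, i < l.length → j < l.length → f i = f j → i = j)

def bIdx : Bool → ℕ
  | false => 0
  | true => 1

/-- The formula occurrence at position `p` of the premise `b` of the rule at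
node `v` is the parent of the occurrence at position `q` of its conclusion. -/
def IsParent (D : Coderivation) (v : Node) (b : Bool) (p q : ℕ) : Prop :=
  ∃ r C P C₀ P₀ ps₀, ∃ f g : ℕ → ℕ,
    D.label v = some (r, C) ∧ D.seqAt (v ++ [b]) = some P ∧
    Canon r C₀ ps₀ ∧ PosAlign C C₀ f ∧ ps₀[bIdx b]? = some P₀ ∧ PosAlign P P₀ g ∧
    childParent r (ps₀.headD []).length b (g p) = some (f q)

/-- The occurrence at position `q` of the conclusion of the rule at `v` is the
principal `!`-formula of a `c!p` rule. -/
def PrincipalCp (D : Coderivation) (v : Node) (q : ℕ) : Prop :=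
  ∃ C C₀ ps₀ f, D.label v = some (.cp, C) ∧ Canon .cp C₀ ps₀ ∧ PosAlign C C₀ f ∧ f q = 0

def Coderivation.formulaAt (D : Coderivation) (v : Node) (q : ℕ) : Option Formula :=
  (D.seqAt v).bind fun Γ => Γ[q]?

/-- The infinite branch `β` carries a progressing `!`-thread: from some point
on, a sequence of parent-linked `!`-formula occurrences which is infinitely
often principal for a `c!p` rule. -/
def ProgThread (D : Coderivation) (β : ℕ → Bool) : Prop :=
  ∃ k, ∃ t : ℕ → ℕ,
    (∀ i, k ≤ i → ∃ A, D.formulaAt (brNode β i) (t i) = some (Formula.bang A)) ∧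
    (∀ i, k ≤ i → IsParent D (brNode β i) (β i) (t (i + 1)) (t i)) ∧
    (∀ N, ∃ i, N ≤ i ∧ k ≤ i ∧ PrincipalCp D (brNode β i) (t i))

/-- Progressing criterion: every infinite branch carries a progressing `!`-thread. -/
def Progressing (D : Coderivation) : Prop := ∀ β, InfBranch D β → ProgThread D β

/-! ## Basic constructors on coderivations -/

def node0 (r : RuleName) (Γ : Sequent) : Coderivation where
  label w := match w with
    | [] => some (r, Γ)
    | _ :: _ => none
  root_isSome := rfl
  prefix_closed := by
    intro v b h
    match v with
    | [] => exact rfl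
    | c :: v' => exact Bool.noConfusion h
  ordered := by
    intro v h
    match v with
    | [] => exact Bool.noConfusion h
    | c :: v' => exact Bool.noConfusion h

def node1 (r : RuleName) (Γ : Sequent) (D : Coderivation) : Coderivation where
  label w := match w with
    | [] => some (r, Γ)
    | false :: w' => D.label w'
    | true :: _ => none
  root_isSome := rfl
  prefix_closed := by
    intro v b h
    match v with
    | [] => exact rfl
    | false :: v' => exact D.prefix_closed v' b h
    | true :: v' => exact Bool.noConfusion h
  ordered := by
    intro v h
    match v with
    | [] => exact Bool.noConfusion h
    | false :: v' => exact D.ordered v' h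
    | true :: v' => exact Bool.noConfusion h

def node2 (r : RuleName) (Γ : Sequent) (D E : Coderivation) : Coderivation where
  label w := match w with
    | [] => some (r, Γ)
    | false :: w' => D.label w'
    | true :: w' => E.label w'
  root_isSome := rfl
  prefix_closed := by
    intro v b h
    match v with
    | [] => exact rfl
    | false :: v' => exact D.prefix_closed v' b h
    | true :: v' => exact E.prefix_closed v' b h
  ordered := by
    intro v h
    match v with
    | [] => exact D.root_isSome
    | false :: v' => exact D.ordered v' h
    | true :: v' => exact E.ordered v' h

/-- The single-node `hyp` open derivation with conclusion `Γ`. -/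
def hypC (Γ : Sequent) : Coderivation := node0 .hyp Γ

/-- The sub-coderivation of `D` rooted at `v` (a default if `v` is not a node of `D`). -/
def Coderivation.subAt (D : Coderivation) (v : Node) : Coderivation :=
  if h : (D.label v).isSome then
    { label := fun w => D.label (v ++ w)
      root_isSome := by simpa using h
      prefix_closed := by
        intro u b hu
        have hu' : (D.label ((v ++ u) ++ [b])).isSome := by
          rw [List.append_assoc]; exact hu
        exact D.prefix_closed (v ++ u) b hu'
      ordered := by
        intro u hu
        have hu' : (D.label ((v ++ u) ++ [true])).isSome := by
          rw [List.append_assoc]; exact hu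
        have h2 := D.ordered (v ++ u) hu'
        show (D.label (v ++ (u ++ [false]))).isSome
        rw [← List.append_assoc]
        exact h2 }
  else node0 .hyp []

/-! ## Non-wellfounded boxes -/

/-- Splits a node into its number of leading `true`s and, if any, the rest of
the address after the first `false`. -/
def leadSplit : Node → ℕ × Option Node
  | [] => (0, none)
  | true :: w => ((leadSplit w).1 + 1, (leadSplit w).2)
  | false :: w => (0, some w)

lemma leadSplit_append_none (w : Node) (h : (leadSplit w).2 = none) :
    leadSplit (w ++ [true]) = ((leadSplit w).1 + 1, none) ∧
    leadSplit (w ++ [false]) = ((leadSplit w).1, some []) := by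
  induction w with
  | nil => exact ⟨rfl, rfl⟩
  | cons c w ih =>
    cases c with
    | false => exact absurd h (by simp [leadSplit])
    | true =>
      have h' : (leadSplit w).2 = none := by simpa [leadSplit] using h
      obtain ⟨h1, h2⟩ := ih h'
      constructor
      · show leadSplit (true :: (w ++ [true])) = _
        simp [leadSplit, h1]
      · show leadSplit (true :: (w ++ [false])) = _
        simp [leadSplit, h2]

lemma leadSplit_append_some (w u : Node) (h : (leadSplit w).2 = some u) (b : Bool) :
    leadSplit (w ++ [b]) = ((leadSplit w).1, some (u ++ [b])) := by
  induction w with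
  | nil => simp [leadSplit] at h
  | cons c w ih =>
    cases c with
    | false =>
      have hw : w = u := by simpa [leadSplit] using h
      subst hw
      simp [leadSplit]
    | true =>
      have h' : (leadSplit w).2 = some u := by simpa [leadSplit] using h
      have := ih h'
      show leadSplit (true :: (w ++ [b])) = _
      simp [leadSplit, this]

/-- The non-wellfounded box with conclusion `Γ`, whose `i`-th call is `g i`:
its main branch `{ε, 2, 22, …}` consists of `c!p` rules. -/
def nwbOf (Γ : Sequent) (g : ℕ → Coderivation) : Coderivation where
  label w := match (leadSplit w).2 with
    | none => some (.cp, Γ)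
    | some u => (g (leadSplit w).1).label u
  root_isSome := rfl
  prefix_closed := by
    intro w b h
    have h' : (match (leadSplit (w ++ [b])).2 with
      | none => some (RuleName.cp, Γ)
      | some u => (g (leadSplit (w ++ [b])).1).label u).isSome := h
    show (match (leadSplit w).2 with
      | none => some (RuleName.cp, Γ)
      | some u => (g (leadSplit w).1).label u).isSome
    rcases hw : (leadSplit w).2 with _ | u
    · rfl
    · have ha := leadSplit_append_some w u hw b
      rw [ha] at h'
      exact (g (leadSplit w).1).prefix_closed u b h'
  ordered := by
    intro w h
    have h' : (match (leadSplit (w ++ [true])).2 with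
      | none => some (RuleName.cp, Γ)
      | some u => (g (leadSplit (w ++ [true])).1).label u).isSome := h
    show (match (leadSplit (w ++ [false])).2 with
      | none => some (RuleName.cp, Γ)
      | some u => (g (leadSplit (w ++ [false])).1).label u).isSome
    rcases hw : (leadSplit w).2 with _ | u
    · have haf := (leadSplit_append_none w hw).2
      rw [haf]
      exact (g (leadSplit w).1).root_isSome
    · have hat := leadSplit_append_some w u hw true
      have haf := leadSplit_append_some w u hw false
      rw [hat] at h'
      rw [haf]
      exact (g (leadSplit w).1).ordered u h'

/-- The node `v` of `D` is the root of a non-wellfounded box. -/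
def IsNwbAt (D : Coderivation) (v : Node) : Prop :=
  ∀ n : ℕ, D.ruleAt (v ++ List.replicate n true) = some .cp

/-- Every `c!p` rule of `D` belongs to the main branch of a non-wellfounded box. -/
def CpInNwb (D : Coderivation) : Prop :=
  ∀ v, D.ruleAt v = some .cp →
    ∃ w k, v = w ++ List.replicate k true ∧ IsNwbAt D w

/-! ## Regularity and finite expandability -/

def Regular (D : Coderivation) : Prop :=
  {E : Coderivation | ∃ v, D.mem v ∧ E = D.subAt v}.Finite

def WeaklyRegular (D : Coderivation) : Prop :=
  {E : Coderivation | ∃ v, D.ruleAt v = some .cp ∧ E = D.subAt (v ++ [false])}.Finite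

def FinExp (D : Coderivation) : Prop :=
  ∀ β, InfBranch D β →
    {n : ℕ | D.ruleAt (brNode β n) = some .cut ∨ D.ruleAt (brNode β n) = some .qb}.Finite

/-- `rPLL∞`: regular, finitely expandable, progressing coderivations of `PLL∞`. -/
def rPLL (D : Coderivation) : Prop := PLLinf D ∧ Progressing D ∧ FinExp D ∧ Regular D

/-- `wrPLL∞`: weakly regular, finitely expandable, progressing coderivations of `PLL∞`. -/
def wrPLL (D : Coderivation) : Prop := PLLinf D ∧ Progressing D ∧ FinExp D ∧ WeaklyRegular D

def CutFree (D : Coderivation) : Prop := ∀ v, D.ruleAt v ≠ some .cut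

/-- No cut-elimination step applies: one premise of each cut is a `hyp`. -/
def Normal (D : Coderivation) : Prop :=
  ∀ v, D.ruleAt v = some .cut →
    D.ruleAt (v ++ [false]) = some .hyp ∨ D.ruleAt (v ++ [true]) = some .hyp

/-! ## Pruning and approximations -/

lemma prefix_snoc_cases {u v : Node} {x : Bool} (h : u <+: v ++ [x]) :
    u <+: v ∨ u = v ++ [x] := by
  rcases Nat.lt_or_ge u.length (v ++ [x]).length with hl | hl
  · left
    have hle : u.length ≤ v.length := by
      have := hl
      simp only [List.length_append, List.length_cons, List.length_nil] at this
      omega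
    exact List.prefix_of_prefix_length_le h (List.prefix_append v [x]) hle
  · right
    exact h.eq_of_length (le_antisymm h.length_le (le_trans hl (le_of_eq rfl)))

open Classical in
noncomputable def pruneLabel (D : Coderivation) (V : Set Node) (w : Node) :
    Option (RuleName × Sequent) :=
  if ∃ v ∈ V, v <+: w ∧ v ≠ w then none
  else if w ∈ V then (D.label w).map fun p => (.hyp, p.2)
  else D.label w

lemma pruneLabel_isSome {D : Coderivation} {V : Set Node} {w : Node}
    (h : (pruneLabel D V w).isSome) :
    (D.label w).isSome ∧ ¬ ∃ v ∈ V, v <+: w ∧ v ≠ w := by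
  classical
  unfold pruneLabel at h
  split_ifs at h with h1 h2
  · exact absurd h (by simp)
  · exact ⟨by simpa using h, h1⟩
  · exact ⟨h, h1⟩

-- Pruning: replace the sub-coderivations of `D` rooted at the nodes of `V` by `hyp`.
open Classical in
noncomputable def prune (D : Coderivation) (V : Set Node) : Coderivation where
  label := pruneLabel D V
  root_isSome := by
    classical
    unfold pruneLabel
    split_ifs with h1 h2
    · exfalso
      obtain ⟨v, _, hpre, hne⟩ := h1
      exact hne (List.prefix_nil.mp hpre)
    · simpa using D.root_isSome
    · exact D.root_isSome
  prefix_closed := by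
    classical
    intro v b h
    obtain ⟨hD, hno⟩ := pruneLabel_isSome h
    have hDv : (D.label v).isSome := D.prefix_closed v b hD
    have hnov : ¬ ∃ u ∈ V, u <+: v ∧ u ≠ v := by
      rintro ⟨u, hu, hpre, hne⟩
      refine hno ⟨u, hu, hpre.trans (List.prefix_append _ _), fun he => ?_⟩
      have hlen := congrArg List.length he
      have hle : u.length ≤ v.length := hpre.length_le
      simp only [List.length_append, List.length_cons, List.length_nil] at hlen
      omega
    have hvnotV : v ∉ V := by
      intro hv
      refine hno ⟨v, hv, List.prefix_append _ _, fun he => ?_⟩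
      have hlen := congrArg List.length he
      simp only [List.length_append, List.length_cons, List.length_nil] at hlen
      omega
    show (pruneLabel D V v).isSome
    unfold pruneLabel
    rw [if_neg hnov, if_neg hvnotV]
    exact hDv
  ordered := by
    classical
    intro v h
    obtain ⟨hDt, hno⟩ := pruneLabel_isSome h
    have hDf : (D.label (v ++ [false])).isSome := D.ordered v hDt
    have hno' : ¬ ∃ u ∈ V, u <+: v ++ [false] ∧ u ≠ v ++ [false] := by
      rintro ⟨u, hu, hpre, hne⟩
      rcases prefix_snoc_cases hpre with hu_v | heq
      · rcases eq_or_ne u v with rfl | hne'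
        · refine hno ⟨u, hu, List.prefix_append _ _, fun he => ?_⟩
          have hlen := congrArg List.length he
          simp only [List.length_append, List.length_cons, List.length_nil] at hlen
          omega
        · refine hno ⟨u, hu, hu_v.trans (List.prefix_append _ _), fun he => ?_⟩
          have hlen := congrArg List.length he
          have hle : u.length ≤ v.length := hu_v.length_le
          simp only [List.length_append, List.length_cons, List.length_nil] at hlen
          omega
      · exact hne heq
    show (pruneLabel D V (v ++ [false])).isSome
    unfold pruneLabel
    rw [if_neg hno']
    by_cases hmem : v ++ [false] ∈ V
    · rw [if_pos hmem]
      simpa using hDf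
    · rw [if_neg hmem]
      exact hDf

/-- `E` approximates `D`: `E` is obtained from `D` by pruning at a set of
pairwise incomparable nodes. -/
def Approx (E D : Coderivation) : Prop :=
  ∃ V : Set Node, (∀ v ∈ V, ∀ w ∈ V, v <+: w → v = w) ∧ E = prune D V

/-- The greatest cut-free approximation of `D`: prune at the minimal cut nodes. -/
noncomputable def cf (D : Coderivation) : Coderivation :=
  prune D {v | D.ruleAt v = some .cut ∧
    ∀ w, w <+: v → w ≠ v → D.ruleAt w ≠ some .cut}

/-! ## Suprema of countable families of open coderivations -/

open Classical in
noncomputable def chainSupLabel (s : ℕ → Coderivation) (w : Node) :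
    Option (RuleName × Sequent) :=
  if h : ∃ i, ((s i).label w).isSome ∧ (s i).ruleAt w ≠ some .hyp then (s h.choose).label w
  else if h2 : ∃ i, ((s i).label w).isSome then (s h2.choose).label w
  else none

lemma chainSupLabel_isSome (s : ℕ → Coderivation) (w : Node) :
    (chainSupLabel s w).isSome ↔ ∃ i, ((s i).label w).isSome := by
  classical
  unfold chainSupLabel
  split_ifs with h1 h2
  · exact ⟨fun _ => ⟨h1.choose, h1.choose_spec.1⟩, fun _ => h1.choose_spec.1⟩
  · exact ⟨fun _ => h2, fun _ => h2.choose_spec⟩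
  · simp [h2]

/-- The supremum of a countable (increasing) family of open coderivations. -/
noncomputable def chainSup (s : ℕ → Coderivation) : Coderivation where
  label := chainSupLabel s
  root_isSome := (chainSupLabel_isSome s []).mpr ⟨0, (s 0).root_isSome⟩
  prefix_closed := by
    intro v b h
    obtain ⟨i, hi⟩ := (chainSupLabel_isSome s _).mp h
    exact (chainSupLabel_isSome s v).mpr ⟨i, (s i).prefix_closed v b hi⟩
  ordered := by
    intro v h
    obtain ⟨i, hi⟩ := (chainSupLabel_isSome s _).mp h
    exact (chainSupLabel_isSome s _).mpr ⟨i, (s i).ordered v hi⟩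

/-! ## Cut elimination steps -/

/-- Iterated weakenings introducing `?Γ` over `E` (of conclusion `Δ`). -/
def weakAll : List Formula → Sequent → Coderivation → Coderivation
  | [], _, E => E
  | A :: Γ, Δ, E => node1 .qw (A.quest :: (Γ.map .quest ++ Δ)) (weakAll Γ Δ E)

/-- Iterated absorptions absorbing the formulas of `Γ`; the root has conclusion `C`. -/
def absAll : List Formula → Sequent → Coderivation → Coderivation
  | [], _, E => E
  | A :: Γ, C, E => node1 .qb C (absAll Γ (A :: C) E)

/-- Root cut-elimination steps (principal and commutative). -/
inductive StepRoot : Coderivation → Coderivation → Prop where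
  | ax (A : Formula) (Δ : Sequent) (E : Coderivation)
      (hE : E.conclusion = A.neg :: Δ) :
      StepRoot (node2 .cut (A.neg :: Δ) (node0 .ax [A, A.neg]) E) E
  | tens_parr (A B : Formula) (Γ Δ Θ : Sequent) (D E₁ E₂ : Coderivation)
      (hD : D.conclusion = A :: B :: Γ)
      (hE₁ : E₁.conclusion = A.neg :: Δ) (hE₂ : E₂.conclusion = B.neg :: Θ) :
      StepRoot
        (node2 .cut (Γ ++ (Δ ++ Θ))
          (node1 .parr (A.parr B :: Γ) D)
          (node2 .tens (A.neg.tens B.neg :: (Δ ++ Θ)) E₁ E₂))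
        (node2 .cut (Γ ++ (Δ ++ Θ))
          (node2 .cut (B :: (Γ ++ Δ)) D E₁) E₂)
  | one_bot (Γ : Sequent) (D : Coderivation) (hD : D.conclusion = Γ) :
      StepRoot (node2 .cut Γ (node1 .bot (.bot :: Γ) D) (node0 .one [.one])) D
  | cp_cp (A B : Formula) (Γ Δ : Sequent) (D₁ D₂ E₁ E₂ : Coderivation)
      (hD₁ : D₁.conclusion = A :: Γ)
      (hD₂ : D₂.conclusion = A.bang :: Γ.map .quest)
      (hE₁ : E₁.conclusion = B :: A.neg :: Δ)
      (hE₂ : E₂.conclusion = B.bang :: A.neg.quest :: Δ.map .quest) :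
      StepRoot
        (node2 .cut (B.bang :: (Γ ++ Δ).map .quest)
          (node2 .cp (A.bang :: Γ.map .quest) D₁ D₂)
          (node2 .cp (B.bang :: A.neg.quest :: Δ.map .quest) E₁ E₂))
        (node2 .cp (B.bang :: (Γ ++ Δ).map .quest)
          (node2 .cut (B :: (Γ ++ Δ)) D₁ E₁)
          (node2 .cut (B.bang :: (Γ ++ Δ).map .quest) D₂ E₂))
  | cp_qw (A : Formula) (Γ Δ : Sequent) (D₁ D₂ E : Coderivation)
      (hD₁ : D₁.conclusion = A :: Γ)
      (hD₂ : D₂.conclusion = A.bang :: Γ.map .quest)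
      (hE : E.conclusion = Δ) :
      StepRoot
        (node2 .cut (Γ.map .quest ++ Δ)
          (node2 .cp (A.bang :: Γ.map .quest) D₁ D₂)
          (node1 .qw (A.neg.quest :: Δ) E))
        (weakAll Γ Δ E)
  | cp_qb (A : Formula) (Γ Δ : Sequent) (D₁ D₂ E : Coderivation)
      (hD₁ : D₁.conclusion = A :: Γ)
      (hD₂ : D₂.conclusion = A.bang :: Γ.map .quest)
      (hE : E.conclusion = A.neg :: A.neg.quest :: Δ) :
      StepRoot
        (node2 .cut (Γ.map .quest ++ Δ)
          (node2 .cp (A.bang :: Γ.map .quest) D₁ D₂)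
          (node1 .qb (A.neg.quest :: Δ) E))
        (absAll Γ (Γ.map .quest ++ Δ)
          (node2 .cut (Γ ++ (Γ.map .quest ++ Δ)) D₁
            (node2 .cut (A.neg :: (Γ.map .quest ++ Δ)) D₂ E)))
  | fp_fp (A B : Formula) (Γ Δ : Sequent) (D E : Coderivation)
      (hD : D.conclusion = A :: Γ) (hE : E.conclusion = B :: A.neg :: Δ) :
      StepRoot
        (node2 .cut (B.bang :: (Γ ++ Δ).map .quest)
          (node1 .fp (A.bang :: Γ.map .quest) D)
          (node1 .fp (B.bang :: A.neg.quest :: Δ.map .quest) E))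
        (node1 .fp (B.bang :: (Γ ++ Δ).map .quest)
          (node2 .cut (B :: (Γ ++ Δ)) D E))
  | fp_qw (A : Formula) (Γ Δ : Sequent) (D E : Coderivation)
      (hD : D.conclusion = A :: Γ) (hE : E.conclusion = Δ) :
      StepRoot
        (node2 .cut (Γ.map .quest ++ Δ)
          (node1 .fp (A.bang :: Γ.map .quest) D)
          (node1 .qw (A.neg.quest :: Δ) E))
        (weakAll Γ Δ E)
  | fp_qb (A : Formula) (Γ Δ : Sequent) (D E : Coderivation)
      (hD : D.conclusion = A :: Γ) (hE : E.conclusion = A.neg :: A.neg.quest :: Δ) :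
      StepRoot
        (node2 .cut (Γ.map .quest ++ Δ)
          (node1 .fp (A.bang :: Γ.map .quest) D)
          (node1 .qb (A.neg.quest :: Δ) E))
        (absAll Γ (Γ.map .quest ++ Δ)
          (node2 .cut (Γ ++ (Γ.map .quest ++ Δ)) D
            (node2 .cut (A.neg :: (Γ.map .quest ++ Δ))
              (node1 .fp (A.bang :: Γ.map .quest) D) E)))
  | comm1 (r : RuleName) (A : Formula) (Γ Γ' Δ : Sequent) (D E : Coderivation)
      (hr : r ≠ .cut)
      (h1 : RuleOk r (A :: Γ) [A :: Γ'])
      (h2 : RuleOk r (Γ ++ Δ) [Γ' ++ Δ])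
      (hD : D.conclusion = A :: Γ') (hE : E.conclusion = A.neg :: Δ) :
      StepRoot (node2 .cut (Γ ++ Δ) (node1 r (A :: Γ) D) E)
               (node1 r (Γ ++ Δ) (node2 .cut (Γ' ++ Δ) D E))
  | comm2a (r : RuleName) (A : Formula) (Γ Γ₁ Γ₂ Δ : Sequent) (D₁ D₂ E : Coderivation)
      (hr : r ≠ .cut)
      (h1 : RuleOk r (A :: Γ) [A :: Γ₁, Γ₂])
      (h2 : RuleOk r (Γ ++ Δ) [Γ₁ ++ Δ, Γ₂])
      (hD₁ : D₁.conclusion = A :: Γ₁) (hE : E.conclusion = A.neg :: Δ) :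
      StepRoot (node2 .cut (Γ ++ Δ) (node2 r (A :: Γ) D₁ D₂) E)
               (node2 r (Γ ++ Δ) (node2 .cut (Γ₁ ++ Δ) D₁ E) D₂)
  | comm2b (r : RuleName) (A : Formula) (Γ Γ₁ Γ₂ Δ : Sequent) (D₁ D₂ E : Coderivation)
      (hr : r ≠ .cut)
      (h1 : RuleOk r (A :: Γ) [Γ₁, A :: Γ₂])
      (h2 : RuleOk r (Γ ++ Δ) [Γ₁, Γ₂ ++ Δ])
      (hD₂ : D₂.conclusion = A :: Γ₂) (hE : E.conclusion = A.neg :: Δ) :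
      StepRoot (node2 .cut (Γ ++ Δ) (node2 r (A :: Γ) D₁ D₂) E)
               (node2 r (Γ ++ Δ) D₁ (node2 .cut (Γ₂ ++ Δ) D₂ E))
  | comm1r (r : RuleName) (A : Formula) (Γ Δ Δ' : Sequent) (D E : Coderivation)
      (hr : r ≠ .cut)
      (h1 : RuleOk r (A.neg :: Δ) [A.neg :: Δ'])
      (h2 : RuleOk r (Γ ++ Δ) [Γ ++ Δ'])
      (hD : D.conclusion = A :: Γ) (hE : E.conclusion = A.neg :: Δ') :
      StepRoot (node2 .cut (Γ ++ Δ) D (node1 r (A.neg :: Δ) E))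
               (node1 r (Γ ++ Δ) (node2 .cut (Γ ++ Δ') D E))
  | comm2ra (r : RuleName) (A : Formula) (Γ Δ Δ₁ Δ₂ : Sequent) (D E₁ E₂ : Coderivation)
      (hr : r ≠ .cut)
      (h1 : RuleOk r (A.neg :: Δ) [A.neg :: Δ₁, Δ₂])
      (h2 : RuleOk r (Γ ++ Δ) [Γ ++ Δ₁, Δ₂])
      (hD : D.conclusion = A :: Γ) (hE₁ : E₁.conclusion = A.neg :: Δ₁) :
      StepRoot (node2 .cut (Γ ++ Δ) D (node2 r (A.neg :: Δ) E₁ E₂))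
               (node2 r (Γ ++ Δ) (node2 .cut (Γ ++ Δ₁) D E₁) E₂)
  | comm2rb (r : RuleName) (A : Formula) (Γ Δ Δ₁ Δ₂ : Sequent) (D E₁ E₂ : Coderivation)
      (hr : r ≠ .cut)
      (h1 : RuleOk r (A.neg :: Δ) [Δ₁, A.neg :: Δ₂])
      (h2 : RuleOk r (Γ ++ Δ) [Δ₁, Γ ++ Δ₂])
      (hD : D.conclusion = A :: Γ) (hE₂ : E₂.conclusion = A.neg :: Δ₂) :
      StepRoot (node2 .cut (Γ ++ Δ) D (node2 r (A.neg :: Δ) E₁ E₂))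
               (node2 r (Γ ++ Δ) E₁ (node2 .cut (Γ ++ Δ₂) D E₂))

/-- A cut-elimination step performed at node `v`. -/
inductive StepAt : Node → Coderivation → Coderivation → Prop where
  | here {D E : Coderivation} : StepRoot D E → StepAt [] D E
  | in1 {v : Node} {D D' : Coderivation} (r : RuleName) (Γ : Sequent) :
      StepAt v D D' → StepAt (false :: v) (node1 r Γ D) (node1 r Γ D')
  | in2l {v : Node} {D D' : Coderivation} (r : RuleName) (Γ : Sequent) (E : Coderivation) :
      StepAt v D D' → StepAt (false :: v) (node2 r Γ D E) (node2 r Γ D' E)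
  | in2r {v : Node} {E E' : Coderivation} (r : RuleName) (Γ : Sequent) (D : Coderivation) :
      StepAt v E E' → StepAt (true :: v) (node2 r Γ D E) (node2 r Γ D E')

/-- One step of cut elimination. -/
def Step (D E : Coderivation) : Prop := ∃ v, StepAt v D E

/-! ## Infinitary cut-elimination strategies -/

/-- Upper bound for the approximation order. -/
def IsUB (S : Set Coderivation) (u : Coderivation) : Prop := ∀ x ∈ S, Approx x u

/-- Least upper bound for the approximation order. -/
def IsLubA (S : Set Coderivation) (u : Coderivation) : Prop :=
  IsUB S u ∧ ∀ w, IsUB S w → Approx u w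

/-- Scott continuity with respect to the approximation order. -/
def ScottCont (f : Coderivation → Coderivation) : Prop :=
  (∀ D E, Approx D E → Approx (f D) (f E)) ∧
  ∀ S u, S.Nonempty → DirectedOn Approx S → IsLubA S u → IsLubA (f '' S) (f u)

/-- An infinitary cut-elimination strategy: for each open coderivation `D`, a
reduction sequence `σ_D` of length `len D ≤ ω`, starting at `D`, performing a
cut-elimination step at each stage, and constant after `len D`. -/
structure Ices where
  seq : Coderivation → ℕ → Coderivation
  len : Coderivation → ℕ∞
  seq_zero : ∀ D, seq D 0 = D
  seq_step : ∀ D (i : ℕ), (i : ℕ∞) < len D → Step (seq D i) (seq D (i + 1))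
  seq_stable : ∀ D (i : ℕ), len D ≤ (i : ℕ∞) → seq D (i + 1) = seq D i

/-- The function computed by an ices: the supremum of the greatest cut-free
approximations along the reduction sequence. -/
noncomputable def fIces (σ : Ices) (D : Coderivation) : Coderivation :=
  chainSup fun i => cf (σ.seq D i)

/-- Maximality: on (finite) open derivations the strategy reaches a normal form. -/
def Ices.Maximal (σ : Ices) : Prop :=
  ∀ D, OPLLinf D → D.IsFinite → ∃ n : ℕ, σ.len D = (n : ℕ∞) ∧ Normal (σ.seq D n)

/-- Maximal and continuous infinitary cut-elimination strategy (mc-ices). -/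
def Ices.IsMc (σ : Ices) : Prop := σ.Maximal ∧ ScottCont (fIces σ)

/-! ## The height-by-height strategy -/

/-- Code of a node: smaller codes mean smaller height, and for equal heights,
more to the left. -/
def nodeCode (v : Node) : ℕ := v.foldl (fun n b => 2 * n + cond b 1 0) 1

open Classical in
noncomputable def hbhNext (D : Coderivation) : Coderivation :=
  if h : ∃ n, ∃ v E, StepAt v D E ∧ nodeCode v = n then
    (Nat.find_spec h).choose_spec.choose
  else D

/-- The height-by-height reduction sequence: at each stage, one cut-elimination
step is applied to the leftmost reducible cut of minimal height. -/
noncomputable def hbhSeq (D : Coderivation) : ℕ → Coderivation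
  | 0 => D
  | n + 1 => hbhNext (hbhSeq D n)

/-- `f_{σ∞}`, the function computed by the height-by-height strategy. -/
noncomputable def fHbh (D : Coderivation) : Coderivation :=
  chainSup fun i => cf (hbhSeq D i)

/-! ## The Scott domain of open coderivations -/

/-- Open coderivations with conclusion `Γ`. -/
def Dom (Γ : Sequent) : Set Coderivation := {D | OPLLinf D ∧ D.conclusion = Γ}

def IsLubOn (Γ : Sequent) (S : Set Coderivation) (u : Coderivation) : Prop :=
  u ∈ Dom Γ ∧ IsUB S u ∧ ∀ w ∈ Dom Γ, IsUB S w → Approx u w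

/-- Compactness in the domain of open coderivations with conclusion `Γ`. -/
def CompactOn (Γ : Sequent) (x : Coderivation) : Prop :=
  ∀ S, S ⊆ Dom Γ → S.Nonempty → DirectedOn Approx S →
    ∀ u, IsLubOn Γ S u → Approx x u → ∃ y ∈ S, Approx x y

/-- Maximality in the domain of open coderivations with conclusion `Γ`. -/
def MaxOn (Γ : Sequent) (x : Coderivation) : Prop :=
  ∀ y ∈ Dom Γ, Approx x y → x = y

/-! ## Relational semantics -/

/-- Codes for points of the relational model (`D_X := ℕ` for each variable):
`uStar` interprets units, `uEl` elements of the web of a variable, `uPair`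
pairs, `uMSet` finite multisets. -/
def uStar : ℕ := Nat.pair 0 0
def uEl (n : ℕ) : ℕ := Nat.pair 1 n
def uPair (a b : ℕ) : ℕ := Nat.pair 2 (Nat.pair a b)
noncomputable def uMSet (m : Multiset ℕ) : ℕ := Nat.pair 3 (Encodable.encode m)

/-- The web of a formula. -/
noncomputable def semF : Formula → Set ℕ
  | .var _ => Set.range uEl
  | .covar _ => Set.range uEl
  | .one => {uStar}
  | .bot => {uStar}
  | .tens A B => {x | ∃ a ∈ semF A, ∃ b ∈ semF B, x = uPair a b}
  | .parr A B => {x | ∃ a ∈ semF A, ∃ b ∈ semF B, x = uPair a b}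
  | .bang A => {x | ∃ m : Multiset ℕ, (∀ a ∈ m, a ∈ semF A) ∧ x = uMSet m}
  | .quest A => {x | ∃ m : Multiset ℕ, (∀ a ∈ m, a ∈ semF A) ∧ x = uMSet m}

/-- Pointwise merge of a tuple of elements into a tuple of multisets. -/
inductive MergeM : List ℕ → List ℕ → List ℕ → Prop where
  | nil : MergeM [] [] []
  | cons (x : ℕ) (m : Multiset ℕ) {xs ms ts : List ℕ} :
      MergeM xs ms ts → MergeM (x :: xs) (uMSet m :: ms) (uMSet (x ::ₘ m) :: ts)

/-- Transport of a tuple along a position alignment. -/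
def AlignedTuple (f : ℕ → ℕ) (t t₀ : List ℕ) : Prop :=
  t.length = t₀.length ∧ ∀ i, i < t.length → t₀[f i]? = t[i]?

/-- The semantic clause of each rule, on canonical instances; `S b` is the
(already transported) interpretation of premise `b`. -/
noncomputable def CanonSem : RuleName → Sequent → (Bool → Set (List ℕ)) → Set (List ℕ)
  | .ax, C₀, _ => {t | ∃ A x, C₀ = [A, A.neg] ∧ x ∈ semF A ∧ t = [x, x]}
  | .cut, _, S => {t | ∃ z u v, (z :: u) ∈ S false ∧ (z :: v) ∈ S true ∧ t = u ++ v}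
  | .tens, _, S =>
      {t | ∃ a b u v, (a :: u) ∈ S false ∧ (b :: v) ∈ S true ∧ t = uPair a b :: (u ++ v)}
  | .parr, _, S => {t | ∃ a b u, (a :: b :: u) ∈ S false ∧ t = uPair a b :: u}
  | .one, _, _ => {[uStar]}
  | .bot, _, S => {t | ∃ u ∈ S false, t = uStar :: u}
  | .qw, _, S => {t | ∃ u ∈ S false, t = uMSet 0 :: u}
  | .qb, _, S =>
      {t | ∃ y, ∃ μ : Multiset ℕ, ∃ u, (y :: uMSet μ :: u) ∈ S false ∧ t = uMSet (y ::ₘ μ) :: u}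
  | .cp, C₀, S =>
      {t | t = List.replicate C₀.length (uMSet 0)} ∪
      {t | ∃ x xs m ms ts, (x :: xs) ∈ S false ∧ (uMSet m :: ms) ∈ S true ∧
        MergeM xs ms ts ∧ t = uMSet (x ::ₘ m) :: ts}
  | .dig, _, S =>
      {t | ∃ ms : List (Multiset ℕ), ∃ u,
        (uMSet ((ms.map uMSet : List ℕ) : Multiset ℕ) :: u) ∈ S false ∧
        t = uMSet ms.sum :: u}
  | _, _, _ => ∅

/-- The `n`-th finite stage of the relational interpretation of a coderivation. -/
noncomputable def interpN : ℕ → Coderivation → Set (List ℕ)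
  | 0, _ => ∅
  | n + 1, D =>
    {t | ∃ r C C₀ ps₀ f t₀,
      D.label [] = some (r, C) ∧ Canon r C₀ ps₀ ∧ PosAlign C C₀ f ∧
      AlignedTuple f t t₀ ∧
      t₀ ∈ CanonSem r C₀ (fun b =>
        {u₀ | ∃ P P₀ g u, D.seqAt [b] = some P ∧ ps₀[bIdx b]? = some P₀ ∧
          PosAlign P P₀ g ∧ AlignedTuple g u u₀ ∧ u ∈ interpN n (D.subAt [b])})}

/-- The relational interpretation `⟦D⟧` of a coderivation. -/
noncomputable def interp (D : Coderivation) : Set (List ℕ) := ⋃ n, interpN n D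

/-! ## Finite (wellfounded) derivations of `PLL` and `nuPLL`, and their translations -/

/-- Finite derivation trees (for `PLL`). -/
inductive PDeriv : Type where
  | p0 (r : RuleName) (Γ : Sequent) : PDeriv
  | p1 (r : RuleName) (Γ : Sequent) (D : PDeriv) : PDeriv
  | p2 (r : RuleName) (Γ : Sequent) (D E : PDeriv) : PDeriv

def PDeriv.concl : PDeriv → Sequent
  | .p0 _ Γ => Γ
  | .p1 _ Γ _ => Γ
  | .p2 _ Γ _ _ => Γ

/-- Valid derivations of the sequent calculus `PLL`. -/
inductive PValid : PDeriv → Prop where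
  | p0 (r : RuleName) (Γ : Sequent) :
      r ∈ pllRules → RuleOk r Γ [] → PValid (.p0 r Γ)
  | p1 (r : RuleName) (Γ : Sequent) (D : PDeriv) :
      r ∈ pllRules → RuleOk r Γ [D.concl] → PValid D → PValid (.p1 r Γ D)
  | p2 (r : RuleName) (Γ : Sequent) (D E : PDeriv) :
      r ∈ pllRules → RuleOk r Γ [D.concl, E.concl] → PValid D → PValid E →
      PValid (.p2 r Γ D E)

/-- The translation `(·)° : PLL → PLL∞`, unfolding each functorial promotion
into a non-wellfounded box all of whose calls are equal. -/
def PDeriv.toCo : PDeriv → Coderivation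
  | .p0 r Γ => node0 r Γ
  | .p1 r Γ D => if r = .fp then nwbOf Γ (fun _ => D.toCo) else node1 r Γ D.toCo
  | .p2 r Γ D E => node2 r Γ D.toCo E.toCo

/-- Wellfounded, infinitely-branching derivation trees (for `nuPLL`). -/
inductive NDeriv : Type where
  | n0 (r : RuleName) (Γ : Sequent) : NDeriv
  | n1 (r : RuleName) (Γ : Sequent) (D : NDeriv) : NDeriv
  | n2 (r : RuleName) (Γ : Sequent) (D E : NDeriv) : NDeriv
  | nup (Γ : Sequent) (f : ℕ → NDeriv) : NDeriv

def NDeriv.concl : NDeriv → Sequent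
  | .n0 _ Γ => Γ
  | .n1 _ Γ _ => Γ
  | .n2 _ Γ _ _ => Γ
  | .nup Γ _ => Γ

def nupllRules : Set RuleName := {.ax, .cut, .tens, .parr, .one, .bot, .qw, .qb}

/-- Valid derivations of `nuPLL`: the infinitely branching promotion `ν!p` has
countably many premises with the same conclusion, finitely many of which are
distinct. -/
inductive NValid : NDeriv → Prop where
  | n0 (r : RuleName) (Γ : Sequent) :
      r ∈ nupllRules → RuleOk r Γ [] → NValid (.n0 r Γ)
  | n1 (r : RuleName) (Γ : Sequent) (D : NDeriv) :
      r ∈ nupllRules → RuleOk r Γ [D.concl] → NValid D → NValid (.n1 r Γ D)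
  | n2 (r : RuleName) (Γ : Sequent) (D E : NDeriv) :
      r ∈ nupllRules → RuleOk r Γ [D.concl, E.concl] → NValid D → NValid E →
      NValid (.n2 r Γ D E)
  | nup (Γ : Sequent) (f : ℕ → NDeriv) :
      (∀ i, NValid (f i)) → (Set.range f).Finite →
      (∀ i, (f i).concl = (f 0).concl) →
      RuleOk .fp Γ [(f 0).concl] →
      NValid (.nup Γ f)

/-- The translation `(·)• : nuPLL → PLL∞`, unfolding each `ν!p` with premises
`(D_i)` into the non-wellfounded box whose `i`-th call is `D_i•`. -/
def NDeriv.toCo : NDeriv → Coderivation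
  | .n0 r Γ => node0 r Γ
  | .n1 r Γ D => node1 r Γ D.toCo
  | .n2 r Γ D E => node2 r Γ D.toCo E.toCo
  | .nup Γ f => nwbOf Γ (fun i => (f i).toCo)

/-! ## The digging counterexample -/

def fX : Formula := .var 0

/-- `N := !(X ⊸ X) ⊸ X ⊸ X = ?(X ⊗ X^⊥) ⅋ (X^⊥ ⅋ X)`. -/
def fN : Formula := (Formula.quest (fX.tens fX.neg)).parr (fX.neg.parr fX)

/-- The derivation `0` of `⊢ N` (weakening over an axiom). -/
def cod0 : Coderivation :=
  node1 .parr [fN]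
    (node1 .parr [.quest (fX.tens fX.neg), fX.neg.parr fX]
      (node1 .qw [.quest (fX.tens fX.neg), fX.neg, fX]
        (node0 .ax [fX.neg, fX])))

/-- The derivation `1` of `⊢ N` (absorption over a weakened tensor of axioms). -/
def cod1 : Coderivation :=
  node1 .parr [fN]
    (node1 .parr [.quest (fX.tens fX.neg), fX.neg.parr fX]
      (node1 .qb [.quest (fX.tens fX.neg), fX.neg, fX]
        (node1 .qw [fX.tens fX.neg, .quest (fX.tens fX.neg), fX.neg, fX]
          (node2 .tens [fX.tens fX.neg, fX.neg, fX]
            (node0 .ax [fX, fX.neg])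
            (node0 .ax [fX.neg, fX])))))

/-- The non-wellfounded box `⟨0,1,0,1,…⟩` of conclusion `⊢ !N`. -/
def boxAlt : Coderivation := nwbOf [fN.bang] fun i => if i % 2 = 0 then cod0 else cod1

/-- Digging applied to the axiom `⊢ ??N^⊥, !!N`. -/
def digCo : Coderivation :=
  node1 .dig [fN.neg.quest, fN.bang.bang]
    (node0 .ax [fN.neg.quest.quest, fN.bang.bang])

/-- The coderivation `D_??d` of `⊢ !!N`. -/
def Ddig : Coderivation := node2 .cut [fN.bang.bang] boxAlt digCo

/-! ## Codes of points -/

lemma uMSet_injective : Function.Injective uMSet := by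
  intro a b h
  simpa [uMSet, Nat.pair_eq_pair] using h

lemma uPair_inj {a b c d : ℕ} : uPair a b = uPair c d ↔ a = c ∧ b = d := by
  simp [uPair, Nat.pair_eq_pair]

/-! ## Aligned tuples -/

/-- The tuple `t` over `C` is carried to the tuple `t₀` over `C₀` by a rearrangement of
positions. -/
def Aligned (C : Sequent) (t : List ℕ) (C₀ : Sequent) (t₀ : List ℕ) : Prop :=
  ∃ f, PosAlign C C₀ f ∧ AlignedTuple f t t₀

lemma Aligned.refl (C : Sequent) (t : List ℕ) : Aligned C t C t :=
  ⟨id, ⟨rfl, fun _ hi => ⟨hi, rfl⟩, fun _ _ _ _ h => h⟩, rfl, fun _ _ => rfl⟩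

lemma Aligned.length_eq {C C₀ : Sequent} {t t₀ : List ℕ} (h : Aligned C t C₀ t₀) :
    C.length = C₀.length := by
  obtain ⟨f, hf, -⟩ := h
  exact hf.1

lemma Aligned.tuple_length_eq {C C₀ : Sequent} {t t₀ : List ℕ} (h : Aligned C t C₀ t₀) :
    t.length = t₀.length := by
  obtain ⟨f, -, hf⟩ := h
  exact hf.1

lemma Aligned.swap (A B : Formula) (Γ : Sequent) (a b : ℕ) (t : List ℕ) :
    Aligned (A :: B :: Γ) (a :: b :: t) (B :: A :: Γ) (b :: a :: t) := by
  refine ⟨Equiv.swap 0 1, ⟨rfl, fun i hi => ?_, fun i j _ _ h => (Equiv.swap 0 1).injective h⟩,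
    rfl, fun i _ => ?_⟩
  · rcases i with _ | _ | i
    · simp
    · simp
    · rw [Equiv.swap_apply_of_ne_of_ne (by omega) (by omega)]
      simpa using hi
  · rcases i with _ | _ | i
    · simp
    · simp
    · rw [Equiv.swap_apply_of_ne_of_ne (by omega) (by omega)]
      simp

lemma Aligned.trans {C C₁ C₂ : Sequent} {t t₁ t₂ : List ℕ} (h : Aligned C t C₁ t₁)
    (h' : Aligned C₁ t₁ C₂ t₂) (hl : t.length = C.length) : Aligned C t C₂ t₂ := by
  obtain ⟨f, ⟨h1, h2, h3⟩, h4, h5⟩ := h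
  obtain ⟨g, ⟨k1, k2, k3⟩, k4, k5⟩ := h'
  refine ⟨g ∘ f, ⟨h1.trans k1, fun i hi => ?_, fun i j hi hj e => ?_⟩, h4.trans k4,
    fun i hi => ?_⟩
  · obtain ⟨a, b⟩ := h2 i hi
    exact ⟨(k2 _ a).1, (k2 _ a).2.trans b⟩
  · exact h3 i j hi hj (k3 _ _ (h2 i hi).1 (h2 j hj).1 e)
  · have := (h2 i (by omega)).1
    exact (k5 (f i) (by omega)).trans (h5 i hi)

lemma Aligned.cons {C C₀ : Sequent} {t t₀ : List ℕ} (h : Aligned C t C₀ t₀) (A : Formula)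
    (a : ℕ) : Aligned (A :: C) (a :: t) (A :: C₀) (a :: t₀) := by
  obtain ⟨f, ⟨h1, h2, h3⟩, h4, h5⟩ := h
  refine ⟨fun i => Nat.casesOn i 0 fun k => f k + 1,
    ⟨by simp [h1], fun i hi => ?_, fun i j hi hj e => ?_⟩, by simp [h4], fun i hi => ?_⟩
  · rcases i with _ | i
    · simp
    · simpa using h2 i (by simpa using hi)
  · rcases i with _ | i <;> rcases j with _ | j
    · rfl
    · simp at e
    · simp at e
    · simp only [Nat.add_right_cancel_iff] at e
      rw [h3 i j (by simpa using hi) (by simpa using hj) e]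
  · rcases i with _ | i
    · simp
    · simpa using h5 i (by simpa using hi)

/-- Aligned tuples decorate the same formulas with the same points. -/
lemma Aligned.mem_zip_iff {C C₀ : Sequent} {t t₀ : List ℕ} (h : Aligned C t C₀ t₀)
    (hl : t.length = C.length) (p : Formula × ℕ) : p ∈ C.zip t ↔ p ∈ C₀.zip t₀ := by
  obtain ⟨f, ⟨h1, h2, h3⟩, -, h5⟩ := h
  simp only [List.mem_iff_getElem?, List.getElem?_zip_eq_some]
  constructor
  · rintro ⟨i, ha, hb⟩
    have hi : i < C.length := (List.getElem?_eq_some_iff.1 ha).1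
    exact ⟨f i, by rw [(h2 i hi).2, ha], by rw [h5 i (by omega), hb]⟩
  · rintro ⟨j, ha, hb⟩
    have hj : j < C₀.length := (List.getElem?_eq_some_iff.1 ha).1
    let F : Fin C.length → Fin C.length := fun i => ⟨f i, by have := (h2 i i.2).1; omega⟩
    have hF : Function.Injective F := fun a b e =>
      Fin.ext (h3 a b a.2 b.2 (congrArg Fin.val e))
    obtain ⟨⟨i, hi⟩, e⟩ := Finite.surjective_of_injective hF ⟨j, h1 ▸ hj⟩
    have e' : f i = j := congrArg Fin.val e
    subst e'
    exact ⟨i, by rw [← (h2 i hi).2, ha], by rw [← h5 i (by omega), hb]⟩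

/-! ## Unfolding the stages of the interpretation -/

/-- The stage-`n` interpretation of the premise `b` at the root of `D`, rearranged to match
the canonical premises `ps₀`. -/
def premSem (n : ℕ) (D : Coderivation) (ps₀ : List Sequent) (b : Bool) : Set (List ℕ) :=
  {u₀ | ∃ P P₀ u, D.seqAt [b] = some P ∧ ps₀[bIdx b]? = some P₀ ∧ Aligned P u P₀ u₀ ∧
    u ∈ interpN n (D.subAt [b])}

lemma mem_interpN_succ {n : ℕ} {D : Coderivation} {t : List ℕ} :
    t ∈ interpN (n + 1) D ↔ ∃ r C C₀ ps₀ t₀, D.label [] = some (r, C) ∧ Canon r C₀ ps₀ ∧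
      Aligned C t C₀ t₀ ∧ t₀ ∈ CanonSem r C₀ (premSem n D ps₀) := by
  have key : ∀ ps₀, (fun b => {u₀ | ∃ P P₀ g u, D.seqAt [b] = some P ∧
      ps₀[bIdx b]? = some P₀ ∧ PosAlign P P₀ g ∧ AlignedTuple g u u₀ ∧
      u ∈ interpN n (D.subAt [b])}) = premSem n D ps₀ := by
    intro ps₀
    funext b
    ext u₀
    constructor
    · rintro ⟨P, P₀, g, u, h1, h2, h3, h4, h5⟩
      exact ⟨P, P₀, u, h1, h2, ⟨g, h3, h4⟩, h5⟩
    · rintro ⟨P, P₀, u, h1, h2, ⟨g, h3, h4⟩, h5⟩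
      exact ⟨P, P₀, g, u, h1, h2, h3, h4, h5⟩
  constructor
  · rintro ⟨r, C, C₀, ps₀, f, t₀, h1, h2, h3, h4, h5⟩
    exact ⟨r, C, C₀, ps₀, t₀, h1, h2, ⟨f, h3, h4⟩, key ps₀ ▸ h5⟩
  · rintro ⟨r, C, C₀, ps₀, t₀, h1, h2, ⟨f, h3, h4⟩, h5⟩
    exact ⟨r, C, C₀, ps₀, f, t₀, h1, h2, h3, h4, (key ps₀).symm ▸ h5⟩

lemma MergeM.length_eq {xs ms ts : List ℕ} (h : MergeM xs ms ts) :
    xs.length = ts.length := by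
  induction h with
  | nil => rfl
  | cons x m _ ih => simp [ih]

lemma Canon.length_of_mem_sem {r : RuleName} {C₀ : Sequent} {ps₀ : List Sequent}
    (hc : Canon r C₀ ps₀) {S : Bool → Set (List ℕ)}
    (hS : ∀ b, ∀ u ∈ S b, ∃ P₀, ps₀[bIdx b]? = some P₀ ∧ u.length = P₀.length)
    {t₀ : List ℕ} (ht : t₀ ∈ CanonSem r C₀ S) : t₀.length = C₀.length := by
  cases hc with
  | ax A => obtain ⟨A', x, -, -, rfl⟩ := ht; rfl
  | cut A Γ Δ =>
    obtain ⟨z, u, v, hu, hv, rfl⟩ := ht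
    have h1 := hS _ _ hu
    have h2 := hS _ _ hv
    simp [bIdx] at h1 h2
    simp [h1, h2]
  | tens A B Γ Δ =>
    obtain ⟨a, b, u, v, hu, hv, rfl⟩ := ht
    have h1 := hS _ _ hu
    have h2 := hS _ _ hv
    simp [bIdx] at h1 h2
    simp [h1, h2]
  | parr A B Γ =>
    obtain ⟨a, b, u, hu, rfl⟩ := ht
    have h1 := hS _ _ hu
    simp [bIdx] at h1
    simp [h1]
  | one => cases ht; rfl
  | bot Γ =>
    obtain ⟨u, hu, rfl⟩ := ht
    have h1 := hS _ _ hu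
    simp [bIdx] at h1
    simp [h1]
  | qw A Γ =>
    obtain ⟨u, hu, rfl⟩ := ht
    have h1 := hS _ _ hu
    simp [bIdx] at h1
    simp [h1]
  | qb A Γ =>
    obtain ⟨y, μ, u, hu, rfl⟩ := ht
    have h1 := hS _ _ hu
    simp [bIdx] at h1
    simp [h1]
  | cp A Γ =>
    rcases ht with rfl | ⟨x, xs, m, ms, ts, hx, -, hm, rfl⟩
    · simp
    · have h1 := hS _ _ hx
      simp [bIdx] at h1
      simp [← hm.length_eq, h1]
  | fp A Γ => exact ht.elim
  | hyp => exact ht.elim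
  | dig A Γ =>
    obtain ⟨ms, u, hu, rfl⟩ := ht
    have h1 := hS _ _ hu
    simp [bIdx] at h1
    simp [h1]

lemma Coderivation.label_subAt {D : Coderivation} {v : Node} (h : (D.label v).isSome)
    (w : Node) : (D.subAt v).label w = D.label (v ++ w) := by
  rw [Coderivation.subAt, dif_pos h]

lemma Coderivation.isSome_of_seqAt {D : Coderivation} {v : Node} {P : Sequent}
    (h : D.seqAt v = some P) : (D.label v).isSome := by
  rw [Coderivation.seqAt, Option.map_eq_some_iff] at h
  obtain ⟨p, hp, -⟩ := h
  simp [hp]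

lemma Coderivation.conclusion_subAt {D : Coderivation} {v : Node} {P : Sequent}
    (h : D.seqAt v = some P) : (D.subAt v).conclusion = P := by
  rw [Coderivation.conclusion, Coderivation.label_subAt (isSome_of_seqAt h), List.append_nil]
  rw [Coderivation.seqAt] at h
  rw [h, Option.getD_some]

/-- The tuples interpreting `D` are indexed by its conclusion. -/
lemma length_of_mem_interpN {n : ℕ} {D : Coderivation} {t : List ℕ} (ht : t ∈ interpN n D) :
    t.length = D.conclusion.length := by
  induction n generalizing D t with
  | zero => exact ht.elim
  | succ n ih =>
    obtain ⟨r, C, C₀, ps₀, t₀, hl, hc, ha, ht₀⟩ := mem_interpN_succ.1 ht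
    have : D.conclusion = C := by simp [Coderivation.conclusion, hl]
    rw [this, ha.length_eq, ha.tuple_length_eq]
    refine hc.length_of_mem_sem ?_ ht₀
    rintro b u₀ ⟨P, P₀, u, h1, h2, h3, h4⟩
    refine ⟨P₀, h2, ?_⟩
    rw [← h3.tuple_length_eq, ih h4, ← h3.length_eq, Coderivation.conclusion_subAt h1]

lemma interpN_of_label {n : ℕ} {D : Coderivation} {r : RuleName} {C : Sequent}
    (hl : D.label [] = some (r, C)) {t : List ℕ} (ht : t ∈ interpN n D) :
    ∃ m C₀ ps₀ t₀, n = m + 1 ∧ Canon r C₀ ps₀ ∧ C.length = C₀.length ∧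
      t.length = C.length ∧ t.length = t₀.length ∧ (∀ p, p ∈ C.zip t ↔ p ∈ C₀.zip t₀) ∧
      t₀ ∈ CanonSem r C₀ (premSem m D ps₀) := by
  rcases n with _ | n
  · exact ht.elim
  have hlen := length_of_mem_interpN ht
  obtain ⟨r', C', C₀, ps₀, t₀, hl', hc, ha, ht₀⟩ := mem_interpN_succ.1 ht
  rw [hl] at hl'
  simp only [Option.some.injEq, Prod.mk.injEq] at hl'
  obtain ⟨rfl, rfl⟩ := hl'
  rw [show D.conclusion = C by simp [Coderivation.conclusion, hl]] at hlen
  exact ⟨n, C₀, ps₀, t₀, rfl, hc, ha.length_eq, hlen, ha.tuple_length_eq,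
    ha.mem_zip_iff hlen, ht₀⟩

lemma exists_of_mem_premSem {n : ℕ} {D : Coderivation} {ps₀ : List Sequent} {b : Bool}
    {P P₀ : Sequent} (hP : D.seqAt [b] = some P) (hP₀ : ps₀[bIdx b]? = some P₀)
    {u₀ : List ℕ} (hu : u₀ ∈ premSem n D ps₀ b) :
    ∃ u ∈ interpN n (D.subAt [b]), P.length = P₀.length ∧ u.length = P.length ∧
      u.length = u₀.length ∧ ∀ p, p ∈ P.zip u ↔ p ∈ P₀.zip u₀ := by
  obtain ⟨P', P₀', u, h1, h2, h3, h4⟩ := hu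
  rw [hP] at h1
  rw [hP₀] at h2
  cases h1
  cases h2
  have hl := length_of_mem_interpN h4
  rw [Coderivation.conclusion_subAt hP] at hl
  exact ⟨u, h4, h3.length_eq, hl, h3.tuple_length_eq, h3.mem_zip_iff hl⟩

/-! ## Sub-coderivations of the basic constructors -/

lemma Coderivation.ext_label {D E : Coderivation} (h : ∀ w, D.label w = E.label w) :
    D = E := by
  cases D
  cases E
  congr
  exact funext h

@[simp] lemma subAt_node1 (r : RuleName) (Γ : Sequent) (D : Coderivation) :
    (node1 r Γ D).subAt [false] = D :=
  Coderivation.ext_label fun w => Coderivation.label_subAt D.root_isSome w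

@[simp] lemma subAt_node2_false (r : RuleName) (Γ : Sequent) (D E : Coderivation) :
    (node2 r Γ D E).subAt [false] = D :=
  Coderivation.ext_label fun w => Coderivation.label_subAt D.root_isSome w

@[simp] lemma subAt_node2_true (r : RuleName) (Γ : Sequent) (D E : Coderivation) :
    (node2 r Γ D E).subAt [true] = E :=
  Coderivation.ext_label fun w => Coderivation.label_subAt E.root_isSome w

@[simp] lemma subAt_nwbOf_false (Γ : Sequent) (g : ℕ → Coderivation) :
    (nwbOf Γ g).subAt [false] = g 0 :=
  Coderivation.ext_label fun w => Coderivation.label_subAt (g 0).root_isSome w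

@[simp] lemma subAt_nwbOf_true (Γ : Sequent) (g : ℕ → Coderivation) :
    (nwbOf Γ g).subAt [true] = nwbOf Γ (fun i => g (i + 1)) :=
  Coderivation.ext_label fun w => Coderivation.label_subAt (D := nwbOf Γ g) rfl w

lemma mem_interpN_node1 {n : ℕ} {r : RuleName} {Γ C₀ P P₀ : Sequent} {D : Coderivation}
    {t t₀ u u₀ : List ℕ} (hc : Canon r C₀ [P₀]) (hP : D.seqAt [] = some P)
    (ht : Aligned Γ t C₀ t₀) (hu : Aligned P u P₀ u₀) (hD : u ∈ interpN n D)
    (hS : ∀ S : Bool → Set (List ℕ), u₀ ∈ S false → t₀ ∈ CanonSem r C₀ S) :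
    t ∈ interpN (n + 1) (node1 r Γ D) := by
  refine mem_interpN_succ.2 ⟨r, Γ, C₀, [P₀], t₀, rfl, hc, ht, hS _ ?_⟩
  exact ⟨P, P₀, u, hP, rfl, hu, by rwa [subAt_node1]⟩

lemma mem_interpN_node2 {n : ℕ} {r : RuleName} {C P Q : Sequent}
    {D E : Coderivation} {t u v : List ℕ} (hc : Canon r C [P, Q]) (hP : D.seqAt [] = some P)
    (hQ : E.seqAt [] = some Q) (hD : u ∈ interpN n D) (hE : v ∈ interpN n E)
    (hS : ∀ S : Bool → Set (List ℕ), u ∈ S false → v ∈ S true → t ∈ CanonSem r C S) :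
    t ∈ interpN (n + 1) (node2 r C D E) := by
  refine mem_interpN_succ.2 ⟨r, C, C, [P, Q], t, rfl, hc, Aligned.refl _ _, hS _ ?_ ?_⟩
  · exact ⟨P, P, u, hP, rfl, Aligned.refl _ _, by rwa [subAt_node2_false]⟩
  · exact ⟨Q, Q, v, hQ, rfl, Aligned.refl _ _, by rwa [subAt_node2_true]⟩

lemma mem_interpN_ax (n : ℕ) (A : Formula) {x : ℕ} (hx : x ∈ semF A) :
    [x, x] ∈ interpN (n + 1) (node0 .ax [A, A.neg]) :=
  mem_interpN_succ.2 ⟨.ax, _, _, _, _, rfl, .ax A, Aligned.refl _ _, A, x, rfl, hx, rfl⟩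

/-! ## Conditional promotion without context -/

section Promotion

variable {D : Coderivation} {B : Formula} {n : ℕ}

lemma nil_mem_interpN_cp (hl : D.label [] = some (.cp, [B.bang])) (n : ℕ) :
    [uMSet 0] ∈ interpN (n + 1) D :=
  mem_interpN_succ.2
    ⟨.cp, _, _, _, [uMSet 0], hl, .cp B [], Aligned.refl _ _, Or.inl rfl⟩

lemma cons_mem_interpN_cp (hl : D.label [] = some (.cp, [B.bang]))
    (h1 : D.seqAt [false] = some [B]) (h2 : D.seqAt [true] = some [B.bang]) {x : ℕ}
    {m : Multiset ℕ} (hx : [x] ∈ interpN n (D.subAt [false]))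
    (hm : [uMSet m] ∈ interpN n (D.subAt [true])) :
    [uMSet (x ::ₘ m)] ∈ interpN (n + 1) D :=
  mem_interpN_succ.2 ⟨.cp, _, _, _, [uMSet (x ::ₘ m)], hl, .cp B [], Aligned.refl _ _,
    Or.inr ⟨x, [], m, [], [], ⟨_, _, _, h1, rfl, Aligned.refl _ _, hx⟩,
      ⟨_, _, _, h2, rfl, Aligned.refl _ _, hm⟩, .nil, rfl⟩⟩

lemma of_mem_interpN_cp (hl : D.label [] = some (.cp, [B.bang]))
    (h1 : D.seqAt [false] = some [B]) (h2 : D.seqAt [true] = some [B.bang])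
    {s : Multiset ℕ} (hs : [uMSet s] ∈ interpN n D) :
    s = 0 ∨ ∃ k x m, n = k + 1 ∧ s = x ::ₘ m ∧ [x] ∈ interpN k (D.subAt [false]) ∧
      [uMSet m] ∈ interpN k (D.subAt [true]) := by
  obtain ⟨k, C₀, ps₀, t₀, rfl, hc, hlen, -, htl, hz, ht₀⟩ := interpN_of_label hl hs
  cases hc with
  | cp A Γ =>
  obtain rfl : Γ = [] := by simpa using hlen.symm
  rcases ht₀ with rfl | ⟨x, xs, m, ms, ts, hx, hm, hM, rfl⟩
  · left
    have := hz (B.bang, uMSet s)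
    simp at this
    exact uMSet_injective this.2
  · right
    obtain rfl : ts = [] := by simpa using htl.symm
    cases hM
    have := hz (B.bang, uMSet s)
    simp at this
    refine ⟨k, x, m, rfl, uMSet_injective this.2, ?_, ?_⟩
    · obtain ⟨u, hu, -, hul, -, huz⟩ := exists_of_mem_premSem h1 rfl hx
      obtain ⟨y, rfl⟩ := List.length_eq_one_iff.1 hul
      have := huz (B, y)
      simp at this
      rwa [this.2] at hu
    · obtain ⟨u, hu, -, hul, -, huz⟩ := exists_of_mem_premSem h2 rfl hm
      obtain ⟨y, rfl⟩ := List.length_eq_one_iff.1 hul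
      have := huz (B.bang, y)
      simp at this
      rwa [this.2] at hu

end Promotion

/-! ## Cut-free coderivations of `⊢ !B` -/

lemma MELLinf.subAt {D : Coderivation} (h : MELLinf D) {v : Node}
    (hv : (D.label v).isSome) : MELLinf (D.subAt v) := by
  intro w r Γ hw
  rw [Coderivation.label_subAt hv] at hw
  have := h _ _ _ hw
  simpa only [Coderivation.premsAt, Coderivation.seqAt, Coderivation.label_subAt hv,
    List.append_assoc] using this

lemma CutFree.subAt {D : Coderivation} (h : CutFree D) {v : Node}
    (hv : (D.label v).isSome) : CutFree (D.subAt v) := by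
  intro w
  have := h (v ++ w)
  rwa [Coderivation.ruleAt, Coderivation.label_subAt hv, ← Coderivation.ruleAt]

/-- A cut-free coderivation of `⊢ !B` ends with a conditional promotion. -/
lemma cp_of_cutFree_bang {D : Coderivation} {B : Formula} (hD : MELLinf D)
    (hcf : CutFree D) (hc : D.conclusion = [B.bang]) :
    D.label [] = some (.cp, [B.bang]) ∧ D.seqAt [false] = some [B] ∧
      D.seqAt [true] = some [B.bang] := by
  obtain ⟨⟨r, Γ⟩, hl⟩ := Option.isSome_iff_exists.1 D.root_isSome
  obtain rfl : Γ = [B.bang] := by simpa [Coderivation.conclusion, hl] using hc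
  obtain ⟨hr, C₀, ps₀, hcan, hperm, hps⟩ := hD [] r _ hl
  have hlen := hperm.length_eq
  have hmem : ∀ A ∈ C₀, A = B.bang := fun A hA => by simpa using hperm.mem_iff.2 hA
  cases hcan with
  | ax A => simp at hlen
  | cut A Γ Δ => exact (hcf [] (by simp [Coderivation.ruleAt, hl])).elim
  | tens A B Γ Δ => simp at hmem
  | parr A B Γ => simp at hmem
  | one => simp at hmem
  | bot Γ => simp at hmem
  | qw A Γ => simp at hmem
  | qb A Γ => simp at hmem
  | dig A Γ => simp at hmem
  | fp A Γ => simp [mellInfRules, pllInfRules] at hr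
  | hyp Γ => simp [mellInfRules, pllInfRules] at hr
  | cp A Γ =>
    obtain rfl : Γ = [] := by simpa using hlen.symm
    obtain rfl : A = B := by simpa using hmem
    refine ⟨hl, ?_⟩
    rw [Coderivation.premsAt, List.nil_append, List.nil_append] at hps
    rcases h1 : D.seqAt [false] with _ | P <;> rcases h2 : D.seqAt [true] with _ | Q <;>
      simp [h1, h2] at hps
    simp [hps]

/-! ## The interpretation of the digging coderivation -/

lemma mem_interpN_cod0 (n a : ℕ) :
    [uPair (uMSet 0) (uPair (uEl a) (uEl a))] ∈ interpN (n + 4) cod0 := by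
  refine mem_interpN_node1 (.parr _ _ []) rfl (Aligned.refl _ _)
    (u := [uMSet 0, uPair (uEl a) (uEl a)]) (Aligned.refl _ _) ?_
    fun S hS => ⟨_, _, _, hS, rfl⟩
  refine mem_interpN_node1 (.parr _ _ _) rfl (Aligned.swap _ _ [] _ _ [])
    (u := [uMSet 0, uEl a, uEl a]) ((Aligned.swap _ _ _ _ _ _).trans
      ((Aligned.swap _ _ [] _ _ []).cons _ _) rfl) ?_ fun S hS => ⟨_, _, _, hS, rfl⟩
  refine mem_interpN_node1 (.qw _ _) rfl (Aligned.refl _ _)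
    (u := [uEl a, uEl a]) (Aligned.refl _ _) ?_ fun S hS => ⟨_, hS, rfl⟩
  exact mem_interpN_ax n fX.neg ⟨a, rfl⟩

lemma mem_interpN_cod1 (n a : ℕ) :
    [uPair (uMSet {uPair (uEl a) (uEl a)}) (uPair (uEl a) (uEl a))] ∈
      interpN (n + 6) cod1 := by
  refine mem_interpN_node1 (.parr _ _ []) rfl (Aligned.refl _ _)
    (u := [uMSet {uPair (uEl a) (uEl a)}, uPair (uEl a) (uEl a)]) (Aligned.refl _ _) ?_
    fun S hS => ⟨_, _, _, hS, rfl⟩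
  refine mem_interpN_node1 (.parr _ _ _) rfl (Aligned.swap _ _ [] _ _ [])
    (u := [uMSet {uPair (uEl a) (uEl a)}, uEl a, uEl a]) ((Aligned.swap _ _ _ _ _ _).trans
      ((Aligned.swap _ _ [] _ _ []).cons _ _) rfl) ?_ fun S hS => ⟨_, _, _, hS, rfl⟩
  refine mem_interpN_node1 (.qb _ _) rfl (Aligned.refl _ _)
    (u := [uPair (uEl a) (uEl a), uMSet 0, uEl a, uEl a]) (Aligned.refl _ _) ?_
    fun S hS => ⟨_, 0, _, hS, rfl⟩
  refine mem_interpN_node1 (.qw _ _) rfl (Aligned.swap _ _ _ _ _ _)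
    (u := [uPair (uEl a) (uEl a), uEl a, uEl a]) (Aligned.refl _ _) ?_
    fun S hS => ⟨_, hS, rfl⟩
  exact mem_interpN_node2 (.tens _ _ [fX.neg] [fX]) rfl rfl
    (mem_interpN_ax n fX ⟨a, rfl⟩) (mem_interpN_ax n fX.neg ⟨a, rfl⟩)
    fun S h1 h2 => ⟨_, _, [_], [_], h1, h2, rfl⟩

/-- Points of `⟦0⟧` do not use their argument. -/
lemma of_mem_interpN_cod0 {n x : ℕ} (h : [x] ∈ interpN n cod0) :
    ∃ b, x = uPair (uMSet 0) b := by
  obtain ⟨n, C₀, ps₀, t₀, rfl, hc, hlen, -, htl, hz, ht₀⟩ := interpN_of_label rfl h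
  cases hc with
  | parr A B Γ =>
  obtain rfl : Γ = [] := by simpa using hlen.symm
  obtain ⟨a, b, u, hu, rfl⟩ := ht₀
  obtain rfl : u = [] := by simpa using htl.symm
  have hx := hz (fN, x)
  simp [fN] at hx
  obtain ⟨⟨rfl, rfl⟩, rfl⟩ := hx
  refine ⟨b, uPair_inj.2 ⟨?_, rfl⟩⟩
  obtain ⟨u, hu', -, hul, -, huz⟩ := exists_of_mem_premSem (D := cod0) rfl rfl hu
  obtain ⟨a', b', rfl⟩ := List.length_eq_two.1 hul
  have ha := huz (.quest (fX.tens fX.neg), a')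
  simp at ha
  subst ha
  clear h htl hlen hz hul huz
  rw [cod0, subAt_node1] at hu'
  obtain ⟨n, C₀, ps₀, t₀, rfl, hc, hlen, -, htl, hz, ht₀⟩ := interpN_of_label rfl hu'
  cases hc with
  | parr A B Γ =>
  obtain ⟨G, rfl⟩ := List.length_eq_one_iff.1 (show Γ.length = 1 by simpa using hlen.symm)
  obtain ⟨p, q, u, hu, rfl⟩ := ht₀
  obtain ⟨g, rfl⟩ := List.length_eq_one_iff.1 (show u.length = 1 by simpa using htl.symm)
  have h1 := hz (.quest (fX.tens fX.neg), a')
  have h2 := hz (A.parr B, uPair p q)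
  simp at h1 h2
  obtain ⟨rfl, rfl⟩ := h1
  obtain ⟨⟨rfl, rfl⟩, -⟩ := h2
  obtain ⟨u, hu'', -, hul, -, huz⟩ := exists_of_mem_premSem rfl rfl hu
  obtain ⟨a, b, c, rfl⟩ := List.length_eq_three.1 hul
  have h1 := huz (.quest (fX.tens fX.neg), a)
  simp [fX, Formula.neg] at h1
  subst h1
  clear htl hlen hz hul huz
  rw [subAt_node1] at hu''
  obtain ⟨n, C₀, ps₀, t₀, rfl, hc, -, -, -, hz, ht₀⟩ := interpN_of_label rfl hu''
  cases hc with
  | qw A Γ =>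
  obtain ⟨u, hu, rfl⟩ := ht₀
  have := hz (A.quest, uMSet 0)
  simp [fX, Formula.neg] at this
  exact this.2.symm

lemma cp_boxAlt : boxAlt.label [] = some (.cp, [fN.bang]) ∧ boxAlt.seqAt [false] = some [fN] ∧
    boxAlt.seqAt [true] = some [fN.bang] :=
  ⟨rfl, rfl, rfl⟩

/-- Points of `⟦D_??d⟧` flatten to points of `⟦boxAlt⟧`. -/
lemma of_mem_interpN_Ddig {n : ℕ} {s : Multiset (Multiset ℕ)}
    (h : [uMSet (s.map uMSet)] ∈ interpN n Ddig) :
    ∃ k, [uMSet s.sum] ∈ interpN k boxAlt := by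
  obtain ⟨n, C₀, ps₀, t₀, rfl, hc, hlen, -, htl, hz, ht₀⟩ := interpN_of_label rfl h
  cases hc with
  | cut A Γ Δ =>
  obtain ⟨z, u, v, hu, hv, rfl⟩ := ht₀
  obtain ⟨u', hbox, hl1, hul, hul', huz⟩ := exists_of_mem_premSem (D := Ddig) rfl rfl hu
  obtain ⟨v', hdig, hl2, hvl, hvl', hvz⟩ := exists_of_mem_premSem (D := Ddig) rfl rfl hv
  rw [Ddig, subAt_node2_false] at hbox
  rw [Ddig, subAt_node2_true] at hdig
  obtain rfl : Γ = [] := by simpa using hl1.symm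
  obtain ⟨y, rfl⟩ := List.length_eq_one_iff.1 hul
  obtain rfl : u = [] := by simpa using hul'.symm
  obtain ⟨C, rfl⟩ := List.length_eq_one_iff.1 (show Δ.length = 1 by simpa using hlen.symm)
  obtain ⟨c, rfl⟩ := List.length_eq_one_iff.1 (show v.length = 1 by simpa using htl.symm)
  obtain ⟨p, q, rfl⟩ := List.length_eq_two.1 hvl
  have h1 := hz (fN.bang.bang, uMSet (s.map uMSet))
  have h2 := huz (fN.bang, y)
  simp at h1 h2
  obtain ⟨rfl, rfl⟩ := h1
  obtain ⟨rfl, rfl⟩ := h2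
  have h3 := hvz (fN.neg.quest, p)
  have h4 := hvz (fN.bang.bang, q)
  simp [Formula.neg] at h3 h4
  subst h3 h4
  clear h htl hlen hz hul hul' huz hvl hvl' hvz hl1 hl2
  obtain ⟨m, C₀, ps₀, t₀, rfl, hc, hlen, -, htl, hz, ht₀⟩ := interpN_of_label rfl hdig
  cases hc with
  | dig A Γ =>
  obtain ⟨ms, u, hw, rfl⟩ := ht₀
  obtain ⟨C, rfl⟩ := List.length_eq_one_iff.1 (show Γ.length = 1 by simpa using hlen.symm)
  obtain ⟨c, rfl⟩ := List.length_eq_one_iff.1 (show u.length = 1 by simpa using htl.symm)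
  have h1 := hz (fN.neg.quest, p)
  have h2 := hz (fN.bang.bang, uMSet (s.map uMSet))
  simp at h1 h2
  obtain ⟨rfl, rfl⟩ := h2
  simp at h1
  obtain ⟨rfl, rfl⟩ := h1
  obtain ⟨w', hax, -, hwl, -, hwz⟩ := exists_of_mem_premSem rfl rfl hw
  rw [digCo, subAt_node1] at hax
  obtain ⟨p, q, rfl⟩ := List.length_eq_two.1 hwl
  have h1 := hwz (fN.neg.quest.quest, p)
  have h2 := hwz (fN.bang.bang, q)
  simp at h1 h2
  subst h1 h2
  clear hlen htl hz hwl hwz hw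
  obtain ⟨m, C₀, ps₀, t₀, rfl, hc, -, -, -, hz, ht₀⟩ := interpN_of_label rfl hax
  obtain ⟨A, x, rfl, -, rfl⟩ := ht₀
  have key : ∀ B a, (B, a) ∈ [A, A.neg].zip [x, x] → a = x := by
    intro B a h
    simp at h
    tauto
  have h1 := key _ _ ((hz (fN.neg.quest.quest, uMSet (ms.map uMSet))).1 (by simp))
  have h2 := key _ _ ((hz (fN.bang.bang, uMSet (s.map uMSet))).1 (by simp))
  have h3 : ((ms : Multiset (Multiset ℕ)).map uMSet) = s.map uMSet :=
    uMSet_injective (h1.trans h2.symm)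
  rw [← Multiset.map_injective uMSet_injective h3, Multiset.sum_coe]
  exact ⟨_, hbox⟩

lemma mem_interpN_Ddig {n : ℕ} {s : Multiset (Multiset ℕ)}
    (h : [uMSet s.sum] ∈ interpN (n + 2) boxAlt)
    (hs : ∀ m ∈ s, ∀ a ∈ m, a ∈ semF fN.neg) :
    [uMSet (s.map uMSet)] ∈ interpN (n + 3) Ddig := by
  obtain ⟨ms, rfl⟩ := Quot.exists_rep s
  refine mem_interpN_node2 (.cut fN.bang [] [fN.bang.bang]) rfl rfl h
    (v := [_, _]) ?_ fun S h1 h2 => ⟨_, [], [_], h1, h2, rfl⟩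
  refine mem_interpN_node1 (.dig fN.neg [fN.bang.bang]) rfl (Aligned.refl _ _)
    (Aligned.refl _ _) (mem_interpN_ax n fN.neg.quest.quest (x := uMSet (ms.map uMSet)) ?_)
    fun S hS => ⟨ms, [_], hS, rfl⟩
  refine ⟨_, fun a ha => ?_, rfl⟩
  obtain ⟨m, hm, rfl⟩ := List.mem_map.1 ha
  exact ⟨m, hs m hm, rfl⟩

lemma singleton_notMem_interpN_boxAlt {n a b : ℕ} :
    [uMSet {uPair (uMSet {a}) b}] ∉ interpN n boxAlt := by
  intro h
  obtain ⟨hl, h1, h2⟩ := cp_boxAlt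
  rcases of_mem_interpN_cp hl h1 h2 h with h | ⟨k, x, m, -, hx, hk, -⟩
  · simp at h
  · rw [boxAlt, subAt_nwbOf_false] at hk
    obtain ⟨b', rfl⟩ := of_mem_interpN_cod0 hk
    have := (uPair_inj.1 ((Multiset.singleton_eq_cons_iff _).1 hx).1).1
    simpa using uMSet_injective this

lemma notMem_interp_Ddig {s : Multiset (Multiset ℕ)} {a b : ℕ}
    (hs : s.sum = {uPair (uMSet {a}) b}) : [uMSet (s.map uMSet)] ∉ interp Ddig := by
  intro h
  obtain ⟨n, hn⟩ := Set.mem_iUnion.1 h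
  obtain ⟨k, hk⟩ := of_mem_interpN_Ddig hn
  rw [hs] at hk
  exact singleton_notMem_interpN_boxAlt hk

/-- One use of each call of the box, distributed by digging over two boxes. -/
lemma mem_interp_Ddig (a : ℕ) :
    [uMSet {uMSet {uPair (uMSet 0) (uPair (uEl a) (uEl a))},
      uMSet {uPair (uMSet {uPair (uEl a) (uEl a)}) (uPair (uEl a) (uEl a))}}] ∈
      interp Ddig := by
  refine Set.mem_iUnion.2 ⟨9, mem_interpN_Ddig
    (s := {{uPair (uMSet 0) (uPair (uEl a) (uEl a))},
      {uPair (uMSet {uPair (uEl a) (uEl a)}) (uPair (uEl a) (uEl a))}}) ?_ ?_⟩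
  · refine cons_mem_interpN_cp (B := fN) rfl rfl rfl
      (x := uPair (uMSet 0) (uPair (uEl a) (uEl a)))
      (m := {uPair (uMSet {uPair (uEl a) (uEl a)}) (uPair (uEl a) (uEl a))}) ?_ ?_
    · exact (subAt_nwbOf_false _ _).symm ▸ mem_interpN_cod0 3 a
    · rw [boxAlt, subAt_nwbOf_true]
      refine cons_mem_interpN_cp (B := fN) rfl rfl rfl (m := 0) ?_
        (nil_mem_interpN_cp (B := fN) ?_ 5)
      · exact (subAt_nwbOf_false _ _).symm ▸ mem_interpN_cod1 0 a
      · rw [subAt_nwbOf_true]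
        rfl
  · have ha : uEl a ∈ semF fX := ⟨a, rfl⟩
    have hp : uPair (uEl a) (uEl a) ∈ semF (fX.neg.parr fX).neg := ⟨_, ha, _, ha, rfl⟩
    have hq : uPair (uEl a) (uEl a) ∈ semF (fX.tens fX.neg).neg := ⟨_, ha, _, ha, rfl⟩
    intro m hm x hx
    simp only [Multiset.insert_eq_cons, Multiset.mem_cons, Multiset.mem_singleton] at hm
    rcases hm with rfl | rfl <;> obtain rfl := Multiset.mem_singleton.1 hx
    · exact ⟨_, ⟨0, by simp, rfl⟩, _, hp, rfl⟩
    · exact ⟨_, ⟨_, by simpa using hq, rfl⟩, _, hp, rfl⟩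

theorem interp_Ddig_ne_of_cutFree {D : Coderivation} (hD : MELLinf D) (hcf : CutFree D)
    (hc : D.conclusion = [fN.bang.bang]) : interp Ddig ≠ interp D := by
  intro heq
  obtain ⟨hl, h1, h2⟩ := cp_of_cutFree_bang hD hcf hc
  have s1 := Coderivation.isSome_of_seqAt h1
  have s2 := Coderivation.isSome_of_seqAt h2
  obtain ⟨hl1, -, -⟩ := cp_of_cutFree_bang (hD.subAt s1) (hcf.subAt s1)
    (Coderivation.conclusion_subAt h1)
  obtain ⟨hl2, -, -⟩ := cp_of_cutFree_bang (hD.subAt s2) (hcf.subAt s2)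
    (Coderivation.conclusion_subAt h2)
  obtain ⟨n, hn⟩ := Set.mem_iUnion.1 (heq ▸ mem_interp_Ddig 0)
  set o := uPair (uMSet {uPair (uEl 0) (uEl 0)}) (uPair (uEl 0) (uEl 0)) with ho
  rcases of_mem_interpN_cp hl h1 h2 hn with h | ⟨k, x, m, rfl, hxm, hx, hm⟩
  · simp at h
  obtain ⟨k, rfl⟩ : ∃ j, k = j + 1 := Nat.exists_eq_succ_of_ne_zero (by rintro rfl; exact hx)
  rw [Multiset.insert_eq_cons, Multiset.cons_eq_cons] at hxm
  rcases hxm with ⟨-, rfl⟩ | ⟨-, cs, hcs, -⟩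
  · refine notMem_interp_Ddig (s := {0, {o}}) (by simp [ho]; rfl) (heq ▸ Set.mem_iUnion.2 ⟨_,
      cons_mem_interpN_cp hl h1 h2 (nil_mem_interpN_cp hl1 k) hm⟩)
  · obtain ⟨rfl, -⟩ := (Multiset.singleton_eq_cons_iff _).1 hcs
    exact notMem_interp_Ddig (s := {{o}}) (by simp [ho]; rfl) (heq ▸ Set.mem_iUnion.2 ⟨_,
      cons_mem_interpN_cp hl h1 h2 hx (nil_mem_interpN_cp hl2 k)⟩)

/-- **Theorem 6.6**: the interpretation of the digging coderivation `D_??d`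
differs from that of every cut-free `MELL∞` coderivation of `⊢ !!N`;
consequently, no cut-elimination relation on a subset of `MELL∞` containing
`D_??d`, extending `→` and reducing every coderivation to a cut-free one with
the same conclusion, can preserve the relational semantics. -/
theorem digging_breaks_semantics :
    (∀ D' : Coderivation, MELLinf D' → CutFree D' →
      D'.conclusion = [fN.bang.bang] → interp Ddig ≠ interp D') ∧
    (∀ X : Set Coderivation, Ddig ∈ X → (∀ D ∈ X, MELLinf D) →
      ∀ R : Coderivation → Coderivation → Prop,
        (∀ D E, Step D E → R D E) →
        (∀ D ∈ X, ∃ D', D' ∈ X ∧ CutFree D' ∧ D'.conclusion = D.conclusion ∧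
          Relation.ReflTransGen R D D') →
        ¬ (∀ D E, R D E → interp D = interp E)) := by
  refine ⟨fun D hD hcf hc => interp_Ddig_ne_of_cutFree hD hcf hc, ?_⟩
  intro X hX hMELL R _ hR hpres
  obtain ⟨D, hDX, hcf, hc, hred⟩ := hR _ hX
  refine interp_Ddig_ne_of_cutFree (hMELL D hDX) hcf hc ?_
  clear hDX hcf hc
  induction hred with
  | refl => rfl
  | tail _ h ih => exact ih.trans (hpres _ _ h)

end NWPLL
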